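/- arXiv:2003.02623 — 3 statements merged into one kernel-verified Lean document; each statement's English description precedes it below -/
import Mathlib

section
/- The minimum expected loss over k-th order sliding-window denoisers equals the integrated Bayes envelope: D^k_{x^n} = ∫_{ℝ^{2k+1}} min_{x̂∈A} Σ_{a∈A} Λ(a, x̂) · p(a, y_{-k}^k) dy_{-k}^k, where p(a, y_{-k}^k) = Σ_{u∈A^{2k+1}: u_0=a} P^k_{x^n}(u) ∏_{j=-k}^k f_{u_j}(y_j). -/
open MeasureTheory Finset

noncomputable section
namespace GenCUDE

/-- The center index of a `(2k+1)`-tuple (0-indexed position `k`). -/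
def center (k : ℕ) : Fin (2*k+1) := ⟨k, by omega⟩

/-- Remove the center coordinate of a `(2k+1)`-tuple, yielding the context (a `2k`-tuple). -/
def dropCenter {α : Type*} (k : ℕ) (y : Fin (2*k+1) → α) : Fin (2*k) → α :=
  fun i => y ((center k).succAbove i)

/-- `p(y_{-k}^k)`: the joint output density of the full `(2k+1)`-tuple. -/
def pFull {M k : ℕ} (f : Fin M → ℝ → ℝ) (P : (Fin (2*k+1) → Fin M) → ℝ)
    (y : Fin (2*k+1) → ℝ) : ℝ :=
  ∑ u : Fin (2*k+1) → Fin M, P u * ∏ j, f (u j) (y j)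

/-- `p(y_{-0})`: the output density of the context. -/
def pCtx {M k : ℕ} (f : Fin M → ℝ → ℝ) (P : (Fin (2*k+1) → Fin M) → ℝ)
    (c : Fin (2*k) → ℝ) : ℝ :=
  ∑ u : Fin (2*k+1) → Fin M, P u * ∏ i, f (dropCenter k u i) (c i)

/-- `p(a, y_{-k}^k)`. -/
def pJoint {M k : ℕ} (f : Fin M → ℝ → ℝ) (P : (Fin (2*k+1) → Fin M) → ℝ)
    (a : Fin M) (y : Fin (2*k+1) → ℝ) : ℝ :=
  ∑ u : Fin (2*k+1) → Fin M,
    (if u (center k) = a then P u * ∏ j, f (u j) (y j) else 0)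

/-- `p(a, y_{-0})`. -/
def pJointCtx {M k : ℕ} (f : Fin M → ℝ → ℝ) (P : (Fin (2*k+1) → Fin M) → ℝ)
    (a : Fin M) (c : Fin (2*k) → ℝ) : ℝ :=
  ∑ u : Fin (2*k+1) → Fin M,
    (if u (center k) = a then P u * ∏ i, f (dropCenter k u i) (c i) else 0)

/-- `P(X_0 = · | y_{-k}^k)`. -/
def postFull {M k : ℕ} (f : Fin M → ℝ → ℝ) (P : (Fin (2*k+1) → Fin M) → ℝ)
    (y : Fin (2*k+1) → ℝ) : Fin M → ℝ :=
  fun a => pJoint f P a y / pFull f P y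

/-- `P(X_0 = · | y_{-0})`. -/
def postCtx {M k : ℕ} (f : Fin M → ℝ → ℝ) (P : (Fin (2*k+1) → Fin M) → ℝ)
    (c : Fin (2*k) → ℝ) : Fin M → ℝ :=
  fun a => pJointCtx f P a c / pCtx f P c

/-- `P(Z_0 = · | y_{-0}) = Σ_a P(X_0=a | y_{-0}) Π(a,·)`. -/
def PZ {M k : ℕ} (f : Fin M → ℝ → ℝ) (P : (Fin (2*k+1) → Fin M) → ℝ)
    (Pi : Matrix (Fin M) (Fin M) ℝ) (c : Fin (2*k) → ℝ) : Fin M → ℝ :=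
  fun z => ∑ a, postCtx f P c a * Pi a z

/-- The approximate posterior `P̂(X_0 = · | y_{-k}^k)` built from the network output `g`. -/
def postHat {M k : ℕ} (f : Fin M → ℝ → ℝ) (P : (Fin (2*k+1) → Fin M) → ℝ)
    (Pi : Matrix (Fin M) (Fin M) ℝ) (g : (Fin (2*k) → ℝ) → Fin M → ℝ)
    (y : Fin (2*k+1) → ℝ) : Fin M → ℝ :=
  fun a => (pCtx f P (dropCenter k y) / pFull f P y)
      * (∑ z, g (dropCenter k y) z * Pi⁻¹ z a) * f a (y (center k))

/-- `b` is a Bayes response with respect to (the not necessarily normalized vector) `v`. -/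
def IsBayes {M : ℕ} (Λ : Matrix (Fin M) (Fin M) ℝ) (v : Fin M → ℝ) (b : Fin M) : Prop :=
  ∀ c : Fin M, ∑ a, Λ a b * v a ≤ ∑ a, Λ a c * v a

/-- Single-letter risk `R(h)` of a sliding-window rule `h` under `P ⊗ C`. -/
def risk {M k : ℕ} (f : Fin M → ℝ → ℝ) (P : (Fin (2*k+1) → Fin M) → ℝ)
    (Λ : Matrix (Fin M) (Fin M) ℝ) (h : (Fin (2*k+1) → ℝ) → Fin M) : ℝ :=
  ∑ u : Fin (2*k+1) → Fin M,
    P u * ∫ y : Fin (2*k+1) → ℝ, Λ (u (center k)) (h y) * ∏ j, f (u j) (y j)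

/-- Extend a `Fin n`-indexed sequence to `ℕ` by zero. -/
def ext {n : ℕ} (y : Fin n → ℝ) : ℕ → ℝ := fun m => if h : m < n then y ⟨m, h⟩ else 0

/-- The window `y_{i-k}^{i+k}` (0-indexed center `i`). -/
def window (k : ℕ) (y : ℕ → ℝ) (i : ℕ) : Fin (2*k+1) → ℝ := fun j => y (i - k + j.val)

/-- The empirical distribution of `(2k+1)`-blocks of `x^n` (0-indexed positions `0,…,n-1`). -/
def empDist (M n k : ℕ) (x : ℕ → Fin M) : (Fin (2*k+1) → Fin M) → ℝ :=
  fun u => (((Finset.Ico k (n - k)).filter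
      fun i => ∀ j : Fin (2*k+1), x (i - k + j.val) = u j).card : ℝ) / ((n - 2*k : ℕ) : ℝ)

/-- The law of `Y^n`: independent coordinates, `Y_i` with density `f_{x_i}`. -/
def lawSeq {M : ℕ} (n : ℕ) (f : Fin M → ℝ → ℝ) (x : ℕ → Fin M) : Measure (Fin n → ℝ) :=
  Measure.pi fun i : Fin n => volume.withDensity fun t => ENNReal.ofReal (f (x i.val) t)

/-- The joint law of the `(2k+1)` noisy outputs under `P ⊗ C`. -/
def lawBlock {M k : ℕ} (f : Fin M → ℝ → ℝ) (P : (Fin (2*k+1) → Fin M) → ℝ) :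
    Measure (Fin (2*k+1) → ℝ) :=
  ∑ u : Fin (2*k+1) → Fin M, ENNReal.ofReal (P u) •
    Measure.pi fun j => volume.withDensity fun t => ENNReal.ofReal (f (u j) t)

/-- The average loss of the sliding-window rule `h` on `(x^n, y^n)`. -/
def avgLoss {M : ℕ} (n k : ℕ) (Λ : Matrix (Fin M) (Fin M) ℝ) (x : ℕ → Fin M)
    (h : (Fin (2*k+1) → ℝ) → Fin M) (y : Fin n → ℝ) : ℝ :=
  (((n - 2*k : ℕ) : ℝ))⁻¹ * ∑ i ∈ Finset.Ico k (n - k), Λ (x i) (h (window k (ext y) i))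


lemma pi_withDensity_aux {ι : Type*} [Fintype ι] (h : ι → ℝ → ℝ)
    (h0 : ∀ j t, 0 ≤ h j t) (hi : ∀ j, Integrable (h j)) :
    (Measure.pi fun j => (volume : Measure ℝ).withDensity fun t => ENNReal.ofReal (h j t))
      = (volume : Measure (ι → ℝ)).withDensity fun y => ENNReal.ofReal (∏ j, h j (y j)) := by
  have hfin : ∀ j, IsFiniteMeasure
      ((volume : Measure ℝ).withDensity fun t => ENNReal.ofReal (h j t)) := fun j =>
    isFiniteMeasure_withDensity_ofReal (hi j).2
  refine (Measure.pi_eq fun s hs => ?_)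
  rw [withDensity_apply _ (MeasurableSet.univ_pi hs), volume_pi, Measure.restrict_pi_pi,
    ← ofReal_integral_eq_lintegral_ofReal, integral_fintype_prod_eq_prod,
    ENNReal.ofReal_prod_of_nonneg]
  · refine Finset.prod_congr rfl fun j _ => ?_
    rw [withDensity_apply _ (hs j), ofReal_integral_eq_lintegral_ofReal]
    · exact (hi j).restrict
    · exact Filter.Eventually.of_forall (h0 j)
  · intro j _
    exact integral_nonneg (h0 j)
  · exact Integrable.fintype_prod fun j => (hi j).restrict
  · exact Filter.Eventually.of_forall fun y => Finset.prod_nonneg fun j _ => h0 j _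

lemma pi_map_precomp_aux {ι κ : Type*} [Fintype ι] [Fintype κ] (μ : ι → Measure ℝ)
    [∀ i, IsProbabilityMeasure (μ i)] (e : κ → ι) (he : Function.Injective e) :
    (Measure.pi μ).map (fun y j => y (e j)) = Measure.pi fun j => μ (e j) := by
  have h1 := ProbabilityTheory.iIndepFun_pi (μ := μ) (X := fun _ t => t)
    (fun i => aemeasurable_id)
  have h2 := h1.precomp he
  rw [ProbabilityTheory.iIndepFun_iff_map_fun_eq_pi_map
    (fun i => (measurable_pi_apply _).aemeasurable)] at h2
  rw [h2]
  congr 1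
  ext1 j
  exact (measurePreserving_eval μ (e j)).map_eq

lemma measurable_argmin {α : Type*} [MeasurableSpace α] {M : ℕ} (hM : 0 < M)
    (F : Fin M → α → ℝ) (hF : ∀ c, Measurable (F c)) :
    ∃ g : α → Fin M, Measurable g ∧ ∀ y c, F (g y) y ≤ F c y := by
  classical
  have : Nonempty (Fin M) := ⟨⟨0, hM⟩⟩
  have hne : ∀ y, (Finset.univ.filter fun c => ∀ d, F c y ≤ F d y).Nonempty := fun y => by
    obtain ⟨c, hc⟩ := Finite.exists_min (fun c => F c y)
    exact ⟨c, by simpa using hc⟩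
  refine ⟨fun y => (Finset.univ.filter fun c => ∀ d, F c y ≤ F d y).min' (hne y), ?_, ?_⟩
  · refine measurable_to_countable' fun c => ?_
    have : (fun y => (Finset.univ.filter fun c => ∀ d, F c y ≤ F d y).min' (hne y)) ⁻¹' {c}
        = {y | (∀ d, F c y ≤ F d y) ∧ ∀ b, (∀ d, F b y ≤ F d y) → c ≤ b} := by
      ext y
      simp only [Set.mem_preimage, Set.mem_singleton_iff, Set.mem_ofPred_eq]
      rw [Finset.min'_eq_iff]
      simp
    rw [this]
    have hm : ∀ c, MeasurableSet {y | ∀ d, F c y ≤ F d y} := fun c => by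
      rw [Set.ofPred_forall]
      exact MeasurableSet.iInter fun d => measurableSet_le (hF c) (hF d)
    rw [Set.ofPred_and]
    refine (hm c).inter ?_
    rw [Set.ofPred_forall]
    refine MeasurableSet.iInter fun b => ?_
    exact (hm b).imp (MeasurableSet.const _)
  · intro y c
    have := Finset.min'_mem _ (hne y)
    simp only [Finset.mem_filter, Finset.mem_univ, true_and] at this
    exact this c

lemma sum_pJoint {M k : ℕ} (f : Fin M → ℝ → ℝ) (P : (Fin (2*k+1) → Fin M) → ℝ)
    (w : Fin M → ℝ) (y : Fin (2*k+1) → ℝ) :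
    ∑ a, w a * pJoint f P a y
      = ∑ u : Fin (2*k+1) → Fin M, P u * (w (u (center k)) * ∏ j, f (u j) (y j)) := by
  unfold pJoint
  simp_rw [Finset.mul_sum]
  rw [Finset.sum_comm]
  refine Finset.sum_congr rfl fun u _ => ?_
  simp only [mul_ite, mul_zero, Finset.sum_ite_eq, Finset.mem_univ, if_true]
  ring

lemma sum_empDist (M n k : ℕ) (x : ℕ → Fin M) (G : (Fin (2*k+1) → Fin M) → ℝ) :
    ∑ u, empDist M n k x u * G u
      = (((n - 2*k : ℕ) : ℝ))⁻¹ *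
        ∑ i ∈ Finset.Ico k (n - k), G (fun j => x (i - k + j.val)) := by
  classical
  rw [← Finset.sum_fiberwise (Finset.Ico k (n - k)) (fun i => fun j : Fin (2*k+1) =>
    x (i - k + j.val)), Finset.mul_sum]
  refine Finset.sum_congr rfl fun u _ => ?_
  rw [Finset.sum_congr rfl (g := fun _ => G u)
    (fun i hi => by rw [(Finset.mem_filter.1 hi).2]), Finset.sum_const, nsmul_eq_mul]
  unfold empDist
  simp only [funext_iff]
  rw [div_eq_mul_inv]
  have : ∀ (p q : ℝ) , p = q → p * ((n - 2*k : ℕ) : ℝ)⁻¹ * G u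
    = ((n - 2*k : ℕ) : ℝ)⁻¹ * (q * G u) := by rintro p q rfl; ring
  apply this
  congr!

lemma integral_window {M : ℕ} (n k : ℕ)
    (f : Fin M → ℝ → ℝ) (hf_meas : ∀ a, Measurable (f a))
    (hf_nonneg : ∀ a t, 0 ≤ f a t) (hf_int : ∀ a, ∫ t, f a t = 1)
    (x : ℕ → Fin M) (i : ℕ) (hi : i ∈ Finset.Ico k (n - k))
    (φ : (Fin (2*k+1) → ℝ) → ℝ) (hφ : Measurable φ) :
    ∫ y : Fin n → ℝ, φ (window k (ext y) i) ∂(lawSeq n f x)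
      = ∫ y : Fin (2*k+1) → ℝ, φ y * ∏ j, f (x (i - k + j.val)) (y j) := by
  rw [Finset.mem_Ico] at hi
  have hint : ∀ a, Integrable (f a) := fun a =>
    Integrable.of_integral_ne_zero (by rw [hf_int a]; exact one_ne_zero)
  have hp : ∀ a, IsProbabilityMeasure
      ((volume : Measure ℝ).withDensity fun t => ENNReal.ofReal (f a t)) := fun a => by
    refine ⟨?_⟩
    rw [withDensity_apply _ MeasurableSet.univ, Measure.restrict_univ,
      ← ofReal_integral_eq_lintegral_ofReal (hint a)
      (Filter.Eventually.of_forall (hf_nonneg a)), hf_int a, ENNReal.ofReal_one]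
  let e : Fin (2*k+1) → Fin n := fun j => ⟨i - k + j.val, by omega⟩
  have he : Function.Injective e := fun a b h => by
    have := congrArg Fin.val h
    simp only [e] at this
    ext; omega
  have hw : ∀ y : Fin n → ℝ, window k (ext y) i = fun j => y (e j) := fun y => by
    ext j
    simp only [window, ext, e]
    rw [dif_pos]
  simp_rw [hw]
  have hm := pi_map_precomp_aux (fun i : Fin n =>
    (volume : Measure ℝ).withDensity fun t => ENNReal.ofReal (f (x i.val) t)) e he
  unfold lawSeq
  rw [← integral_map (φ := fun (y : Fin n → ℝ) j => y (e j)) (f := φ)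
    (measurable_pi_lambda _ fun j => measurable_pi_apply _).aemeasurable
    hφ.aestronglyMeasurable, hm,
    pi_withDensity_aux (fun j t => f (x (e j).val) t) (fun j => hf_nonneg _) (fun j => hint _),
    integral_withDensity_eq_integral_toReal_smul]
  · refine integral_congr_ae (Filter.Eventually.of_forall fun y => ?_)
    simp only [smul_eq_mul]
    rw [ENNReal.toReal_ofReal (Finset.prod_nonneg fun j _ => hf_nonneg _ _), mul_comm]
  · exact (Finset.measurable_prod _ fun j _ =>
      (hf_meas _).comp (measurable_pi_apply j)).ennreal_ofReal
  · exact Filter.Eventually.of_forall fun y => ENNReal.ofReal_lt_top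

lemma integrable_term {M k : ℕ} (f : Fin M → ℝ → ℝ) (hint : ∀ a, Integrable (f a))
    (Λ : Matrix (Fin M) (Fin M) ℝ) (Λmax : ℝ) (hΛ : ∀ a b, Λ a b ∈ Set.Icc 0 Λmax)
    (g : (Fin (2*k+1) → ℝ) → Fin M) (hg : Measurable g) (u : Fin (2*k+1) → Fin M) :
    Integrable fun y : Fin (2*k+1) → ℝ => Λ (u (center k)) (g y) * ∏ j, f (u j) (y j) := by
  refine Integrable.bdd_mul (c := Λmax) (Integrable.fintype_prod fun j => hint _) ?_ ?_
  · exact ((measurable_of_countable _).comp hg).aestronglyMeasurable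
  · refine Filter.Eventually.of_forall fun y => ?_
    rw [Real.norm_of_nonneg (hΛ _ _).1]
    exact (hΛ _ _).2

/-- the minimum expected loss over measurable `k`-th order sliding-window
denoisers equals the integrated Bayes envelope:
`D^k_{x^n} = ∫ min_{x̂} Σ_a Λ(a,x̂) p(a, y_{-k}^k) dy_{-k}^k`, where
`p(a, y) = Σ_{u : u_0 = a} P^k_{x^n}(u) ∏_j f_{u_j}(y_j)`. -/
theorem statement8
    (M n k : ℕ) (hM : 2 ≤ M) (hk : 1 ≤ k) (hn : 2*k < n)
    (f : Fin M → ℝ → ℝ) (hf_meas : ∀ a, Measurable (f a))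
    (hf_nonneg : ∀ a t, 0 ≤ f a t) (hf_int : ∀ a, ∫ t, f a t = 1)
    (Λ : Matrix (Fin M) (Fin M) ℝ) (Λmax : ℝ) (hΛmax : 0 < Λmax)
    (hΛ : ∀ a b, Λ a b ∈ Set.Icc 0 Λmax)
    (x : ℕ → Fin M) :
    (⨅ gk : {g : (Fin (2*k+1) → ℝ) → Fin M // Measurable g},
        ∫ y : Fin n → ℝ, avgLoss n k Λ x gk.1 y ∂(lawSeq n f x))
      = ∫ y : Fin (2*k+1) → ℝ,
          ⨅ c : Fin M, ∑ a, Λ a c * pJoint f (empDist M n k x) a y := by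
  have hint : ∀ a, Integrable (f a) := fun a =>
    Integrable.of_integral_ne_zero (by rw [hf_int a]; exact one_ne_zero)
  have : Nonempty (Fin M) := ⟨⟨0, by omega⟩⟩
  have hp : ∀ a, IsProbabilityMeasure
      ((volume : Measure ℝ).withDensity fun t => ENNReal.ofReal (f a t)) := fun a => by
    refine ⟨?_⟩
    rw [withDensity_apply _ MeasurableSet.univ, Measure.restrict_univ,
      ← ofReal_integral_eq_lintegral_ofReal (hint a)
      (Filter.Eventually.of_forall (hf_nonneg a)), hf_int a, ENNReal.ofReal_one]
  have : IsProbabilityMeasure (lawSeq n f x) := by unfold lawSeq; infer_instance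
  set P := empDist M n k x with hP
  -- integrability of the risk integrand
  have hI : ∀ g : (Fin (2*k+1) → ℝ) → Fin M, Measurable g →
      Integrable fun y => ∑ a, Λ a (g y) * pJoint f P a y := fun g hg => by
    have h : (fun y => ∑ a, Λ a (g y) * pJoint f P a y) = fun y =>
        ∑ u : Fin (2*k+1) → Fin M, P u * (Λ (u (center k)) (g y) * ∏ j, f (u j) (y j)) :=
      funext fun y => sum_pJoint f P (fun a => Λ a (g y)) y
    rw [h]
    exact integrable_finsetSum _ fun u _ =>
      (integrable_term f hint Λ Λmax hΛ g hg u).const_mul _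
  -- the expected loss of a sliding-window rule
  have hrisk : ∀ g : (Fin (2*k+1) → ℝ) → Fin M, Measurable g →
      ∫ y : Fin n → ℝ, avgLoss n k Λ x g y ∂(lawSeq n f x)
        = ∫ y, ∑ a, Λ a (g y) * pJoint f P a y := fun g hg => by
    have h : (fun y => ∑ a, Λ a (g y) * pJoint f P a y) = fun y =>
        ∑ u : Fin (2*k+1) → Fin M, P u * (Λ (u (center k)) (g y) * ∏ j, f (u j) (y j)) :=
      funext fun y => sum_pJoint f P (fun a => Λ a (g y)) y
    rw [h]
    rw [integral_finsetSum _ fun u _ =>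
      (integrable_term f hint Λ Λmax hΛ g hg u).const_mul _]
    simp_rw [integral_const_mul]
    rw [hP, sum_empDist]
    unfold avgLoss
    rw [integral_const_mul, integral_finsetSum]
    · congr 1
      refine Finset.sum_congr rfl fun i hi => ?_
      rw [integral_window n k f hf_meas hf_nonneg hf_int x i hi
        (fun y => Λ (x i) (g y)) ((measurable_of_countable _).comp hg)]
      have : i - k + (center k).val = i := by
        rw [Finset.mem_Ico] at hi
        simp only [center]; omega
      beta_reduce
      rw [this]
    · intro i hi
      refine Integrable.of_bound (C := Λmax) ?_ ?_
      · refine Measurable.aestronglyMeasurable ?_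
        refine (measurable_of_countable (fun c => Λ (x i) c)).comp (hg.comp ?_)
        refine measurable_pi_lambda _ fun j => ?_
        simp only [window, ext]
        split_ifs
        · exact measurable_pi_apply _
        · exact measurable_const
      · refine Filter.Eventually.of_forall fun y => ?_
        rw [Real.norm_of_nonneg (hΛ _ _).1]
        exact (hΛ _ _).2
  -- measurable Bayes response
  have hpm : ∀ c, Measurable fun y => ∑ a, Λ a c * pJoint f P a y := fun c => by
    refine Finset.measurable_sum _ fun a _ => Measurable.const_mul ?_ _
    unfold pJoint
    refine Finset.measurable_sum _ fun u _ => ?_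
    split_ifs
    · exact (Finset.measurable_prod _ fun j _ =>
        (hf_meas _).comp (measurable_pi_apply j)).const_mul _
    · exact measurable_const
  obtain ⟨g, hg, hgmin⟩ := measurable_argmin (M := M) (by omega)
    (fun c y => ∑ a, Λ a c * pJoint f P a y) hpm
  have henv : ∀ y, (⨅ c : Fin M, ∑ a, Λ a c * pJoint f P a y)
      = ∑ a, Λ a (g y) * pJoint f P a y := fun y =>
    le_antisymm (ciInf_le (Set.finite_range _).bddBelow (g y)) (le_ciInf fun c => hgmin y c)
  simp_rw [henv]
  have hlow : ∀ gk : {g : (Fin (2*k+1) → ℝ) → Fin M // Measurable g},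
      ∫ y, ∑ a, Λ a (g y) * pJoint f P a y
        ≤ ∫ y : Fin n → ℝ, avgLoss n k Λ x gk.1 y ∂(lawSeq n f x) := fun gk => by
    rw [hrisk gk.1 gk.2]
    exact integral_mono (hI g hg) (hI gk.1 gk.2) fun y => hgmin y (gk.1 y)
  have : Nonempty {g : (Fin (2*k+1) → ℝ) → Fin M // Measurable g} := ⟨⟨g, hg⟩⟩
  refine le_antisymm ?_ (le_ciInf hlow)
  refine (ciInf_le ⟨_, by rintro _ ⟨gk, rfl⟩; exact hlow gk⟩ ⟨g, hg⟩).trans ?_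
  exact (hrisk g hg).le

end GenCUDE
end
end

section
/- Assume (2k+1) divides (n−2k). Then for every measurable rule g_k : ℝ^{2k+1} → A and every ε > 0, Pr( | (1/(n−2k)) Σ_{i=k+1}^{n−k} Λ(x_i, g_k(Y_{i−k}^{i+k})) − R(g_k) | > ε ) ≤ 2·(2k+1)·exp( −2(n−2k)·ε² / ((2k+1)·Λ_max²) ), where the probability is over Y^n. -/
open MeasureTheory Finset

noncomputable section
namespace GenCUDE

open ProbabilityTheory in
lemma hoeffding_two_sided {Ω : Type*} {mΩ : MeasurableSpace Ω} (μ : Measure Ω)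
    [IsProbabilityMeasure μ] (m : ℕ) (hm : 0 < m) (X : Fin m → Ω → ℝ)
    (hX : ∀ i, Measurable (X i)) (L : ℝ) (hL : 0 < L) (hb : ∀ i ω, X i ω ∈ Set.Icc 0 L)
    (hind : iIndepFun X μ) (ε : ℝ) (hε : 0 < ε) :
    μ {ω | m * ε < |∑ i, (X i ω - ∫ ω, X i ω ∂μ)|}
      ≤ ENNReal.ofReal (2 * Real.exp (-(2 * m * ε^2) / L^2)) := by
  have hsub : ∀ i, HasSubgaussianMGF (fun ω => X i ω - ∫ ω, X i ω ∂μ) ((‖L - 0‖₊ / 2) ^ 2) μ :=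
    fun i => hasSubgaussianMGF_of_mem_Icc (hX i).aemeasurable (ae_of_all _ (hb i))
  have hind2 : iIndepFun (fun i ω => X i ω - ∫ ω, X i ω ∂μ) μ :=
    hind.comp (fun i t => t - ∫ ω, X i ω ∂μ) (fun i => by fun_prop)
  have hS := HasSubgaussianMGF.sum_of_iIndepFun hind2 (s := Finset.univ) (fun i _ => hsub i)
  have hme : (0:ℝ) ≤ m * ε := by positivity
  have h1 := hS.measure_ge_le hme
  have h2 := hS.neg.measure_ge_le hme
  have hexp : -(m * ε) ^ 2 / (2 * ((∑ i : Fin m, ((‖L - 0‖₊ / 2) ^ 2) : NNReal) : ℝ))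
      = -(2 * m * ε^2) / L^2 := by
    have hm' : (m : ℝ) ≠ 0 := by positivity
    simp
    rw [abs_of_pos hL]
    field_simp
  rw [hexp] at h1 h2
  have hsubset : {ω | m * ε < |∑ i, (X i ω - ∫ ω, X i ω ∂μ)|} ⊆
      {ω | m * ε ≤ ∑ i, (X i ω - ∫ ω, X i ω ∂μ)} ∪
      {ω | m * ε ≤ (-fun ω => ∑ i, (X i ω - ∫ ω, X i ω ∂μ)) ω} := by
    intro ω hω
    have hω : m * ε < |∑ i, (X i ω - ∫ ω, X i ω ∂μ)| := hω
    rcases lt_abs.1 hω with h | h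
    · exact Or.inl h.le
    · exact Or.inr h.le
  refine (ENNReal.le_ofReal_iff_toReal_le (measure_ne_top _ _) (by positivity)).2 ?_
  calc _ ≤ μ.real _ := measureReal_mono hsubset
    _ ≤ _ := measureReal_union_le _ _
    _ ≤ _ := by rw [two_mul]; exact add_le_add h1 h2

lemma pi_withDensity_ofReal {ι : Type*} [Fintype ι] (f : ι → ℝ → ℝ)
    (hf : ∀ i t, 0 ≤ f i t) (hfI : ∀ i, Integrable (f i))
    (hm : ∀ i, Measurable (f i)) :
    Measure.pi (fun i => volume.withDensity fun t => ENNReal.ofReal (f i t))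
      = (volume : Measure (ι → ℝ)).withDensity fun y => ENNReal.ofReal (∏ i, f i (y i)) := by
  classical
  have hfin : ∀ i, IsFiniteMeasure (volume.withDensity fun t => ENNReal.ofReal (f i t)) :=
    fun i => isFiniteMeasure_withDensity_ofReal (hfI i).2
  refine Measure.pi_eq fun s hs => ?_
  have hpi : MeasurableSet (Set.univ.pi s) := MeasurableSet.univ_pi hs
  rw [withDensity_apply _ hpi, ← lintegral_indicator hpi]
  have h1 : ∀ y : ι → ℝ, (Set.univ.pi s).indicator
      (fun y : ι → ℝ => ENNReal.ofReal (∏ i, f i (y i))) y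
      = ENNReal.ofReal (∏ i, (s i).indicator (f i) (y i)) := by
    intro y
    by_cases hy : y ∈ Set.univ.pi s
    · rw [Set.indicator_of_mem hy]
      congr 1
      exact Finset.prod_congr rfl fun i _ => (Set.indicator_of_mem (hy i trivial) _).symm
    · rw [Set.indicator_of_notMem hy]
      simp only [Set.mem_pi, Set.mem_univ, true_imp_iff, not_forall] at hy
      obtain ⟨i, hi⟩ := hy
      rw [Finset.prod_eq_zero (Finset.mem_univ i) (Set.indicator_of_notMem hi _)]
      simp
  have hfI' : ∀ i, Integrable ((s i).indicator (f i)) := fun i => (hfI i).indicator (hs i)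
  have hnn : ∀ i t, 0 ≤ (s i).indicator (f i) t :=
    fun i t => Set.indicator_nonneg (fun t _ => hf i t) t
  simp_rw [h1]
  rw [← ofReal_integral_eq_lintegral_ofReal (μ := (volume : Measure (ι → ℝ)))
    (Integrable.fintype_prod hfI')
    (ae_of_all _ fun y => Finset.prod_nonneg fun i _ => hnn i _),
    integral_fintype_prod_volume_eq_prod,
    ENNReal.ofReal_prod_of_nonneg (fun i _ => integral_nonneg (hnn i))]
  refine Finset.prod_congr rfl fun i _ => ?_
  rw [ofReal_integral_eq_lintegral_ofReal (hfI' i) (ae_of_all _ (hnn i)),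
    withDensity_apply _ (hs i), ← lintegral_indicator (hs i)]
  refine lintegral_congr fun t => ?_
  by_cases ht : t ∈ s i <;> simp [ht]

/-- law of a sub-tuple -/
lemma map_pi_inj {ι κ : Type*} [Fintype ι] [Fintype κ] (P : ι → Measure ℝ)
    [∀ i, IsProbabilityMeasure (P i)] (e : κ → ι) (he : Function.Injective e) :
    (Measure.pi P).map (fun ω i => ω (e i)) = Measure.pi (fun i => P (e i)) := by
  rw [← Measure.infinitePi_eq_pi, ← Measure.infinitePi_eq_pi]
  exact Measure.map_infinitePi_infinitePi_of_inj he

open ProbabilityTheory in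
lemma indep_blocks {ι κ l : Type*} [Fintype ι] [Fintype κ] [Fintype l] (P : ι → Measure ℝ)
    [∀ i, IsProbabilityMeasure (P i)] (e : l → κ → ι)
    (he : Function.Injective (fun p : l × κ => e p.1 p.2)) :
    iIndepFun (fun a (ω : ι → ℝ) (b : κ) => ω (e a b)) (Measure.pi P) := by
  rw [iIndepFun_iff_map_fun_eq_pi_map (fun i => (by fun_prop : Measurable _).aemeasurable)]
  have h1 := map_pi_inj P _ he
  have h2 : ∀ a, (Measure.pi P).map (fun (ω : ι → ℝ) (b : κ) => ω (e a b))
      = Measure.pi (fun b => P (e a b)) := fun a => map_pi_inj P (e a) (fun b b' h => by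
        have := he (a₁ := (a, b)) (a₂ := (a, b')) h
        exact (Prod.mk.inj this).2)
  simp_rw [h2]
  have h3 := Measure.infinitePi_map_curry (fun a b => P (e a b))
  simp_rw [Measure.infinitePi_eq_pi] at h3
  rw [← h3, ← h1, Measure.map_map (by fun_prop) (by fun_prop)]
  rfl

lemma sum_range_blocks (d m : ℕ) (g : ℕ → ℝ) :
    ∑ i ∈ Finset.range (d * m), g i = ∑ r ∈ Finset.range d, ∑ l : Fin m, g (r + d * l) := by
  have h0 : ∀ r, ∑ l : Fin m, g (r + d * l) = ∑ l ∈ Finset.range m, g (r + d * l) :=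
    fun r => Fin.sum_univ_eq_sum_range (fun l => g (r + d * l)) m
  simp_rw [h0]
  clear h0
  induction m with
  | zero => simp
  | succ m ih =>
    rw [Nat.mul_succ, Finset.sum_range_add, ih, ← Finset.sum_add_distrib]
    refine Finset.sum_congr rfl fun r _ => ?_
    rw [Finset.sum_range_succ, add_comm (d * m) r]

lemma risk_eq {M : ℕ} (n k : ℕ) (f : Fin M → ℝ → ℝ) (Λ : Matrix (Fin M) (Fin M) ℝ)
    (x : ℕ → Fin M) (gk : (Fin (2*k+1) → ℝ) → Fin M) :
    risk f (empDist M n k x) Λ gk = (((n - 2*k : ℕ) : ℝ))⁻¹ * ∑ i ∈ Finset.Ico k (n - k),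
      ∫ y : Fin (2*k+1) → ℝ, Λ (x i) (gk y) * ∏ j, f (x (i - k + j.val)) (y j) := by
  classical
  set I : (Fin (2*k+1) → Fin M) → ℝ := fun u =>
    ∫ y : Fin (2*k+1) → ℝ, Λ (u (center k)) (gk y) * ∏ j, f (u j) (y j) with hI
  have h1 : ∑ i ∈ Finset.Ico k (n - k),
      ∫ y : Fin (2*k+1) → ℝ, Λ (x i) (gk y) * ∏ j, f (x (i - k + j.val)) (y j)
      = ∑ i ∈ Finset.Ico k (n - k), I (fun j => x (i - k + j.val)) := by
    refine Finset.sum_congr rfl fun i hi => ?_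
    have : i - k + k = i := by have := (Finset.mem_Ico.1 hi).1; omega
    simp only [hI, center, this]
  rw [h1, ← Finset.sum_fiberwise (Finset.Ico k (n - k)) (fun i => fun j : Fin (2*k+1) => x (i - k + j.val)),
    Finset.mul_sum]
  unfold risk empDist
  refine Finset.sum_congr rfl fun u _ => ?_
  have h2 : ∑ i ∈ (Finset.Ico k (n - k)).filter
      (fun i => (fun j : Fin (2*k+1) => x (i - k + j.val)) = u), I (fun j => x (i - k + j.val))
      = ∑ i ∈ (Finset.Ico k (n - k)).filter
      (fun i => (fun j : Fin (2*k+1) => x (i - k + j.val)) = u), I u := by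
    refine Finset.sum_congr rfl fun i hi => ?_
    rw [(Finset.mem_filter.1 hi).2]
  rw [h2, Finset.sum_const, nsmul_eq_mul]
  simp only [funext_iff]
  rw [div_eq_inv_mul, mul_assoc]

/-- Lemma 6 of the paper: concentration of the average loss of any
measurable sliding-window rule around its single-letter risk:
`Pr(|L − R(g_k)| > ε) ≤ 2(2k+1) exp(−2(n−2k)ε² / ((2k+1) Λ_max²))`. -/
theorem statement11
    (M n k : ℕ) (hM : 2 ≤ M) (hk : 1 ≤ k) (hn : 2*k < n)
    (hdiv : (2*k+1) ∣ (n - 2*k))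
    (f : Fin M → ℝ → ℝ) (hf_meas : ∀ a, Measurable (f a))
    (hf_nonneg : ∀ a t, 0 ≤ f a t) (hf_int : ∀ a, ∫ t, f a t = 1)
    (Λ : Matrix (Fin M) (Fin M) ℝ) (Λmax : ℝ) (hΛmax : 0 < Λmax)
    (hΛ : ∀ a b, Λ a b ∈ Set.Icc 0 Λmax)
    (x : ℕ → Fin M)
    (gk : (Fin (2*k+1) → ℝ) → Fin M) (hgk : Measurable gk)
    (ε : ℝ) (hε : 0 < ε) :
    lawSeq n f x {y : Fin n → ℝ |
        ε < |avgLoss n k Λ x gk y - risk f (empDist M n k x) Λ gk|}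
      ≤ ENNReal.ofReal (2 * (2*k+1) *
          Real.exp (-(2 * ((n - 2*k : ℕ) : ℝ) * ε^2) / ((2*k+1) * Λmax^2))) := by
  classical
  obtain ⟨m, hm⟩ := hdiv
  have hm0 : 0 < m := by
    rcases Nat.eq_zero_or_pos m with h | h
    · subst h; omega
    · exact h
  have hfI : ∀ a, Integrable (f a) := fun a => by
    by_contra h
    have := hf_int a
    rw [integral_undef h] at this
    exact zero_ne_one this
  have hprob : ∀ a, IsProbabilityMeasure
      ((volume : Measure ℝ).withDensity fun t => ENNReal.ofReal (f a t)) := fun a => by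
    constructor
    rw [withDensity_apply _ MeasurableSet.univ, Measure.restrict_univ,
      ← ofReal_integral_eq_lintegral_ofReal (hfI a) (ae_of_all _ (hf_nonneg a)), hf_int]
    simp
  set μ := lawSeq n f x with hμ
  have hμprob : IsProbabilityMeasure μ := by rw [hμ, lawSeq]; infer_instance
  set E : ℕ → ℝ := fun i =>
    ∫ y : Fin (2*k+1) → ℝ, Λ (x i) (gk y) * ∏ j, f (x (i - k + j.val)) (y j) with hE
  set Z : ℕ → (Fin n → ℝ) → ℝ := fun i y => Λ (x i) (gk (window k (ext y) i)) with hZ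
  have hlam : ∀ a, Measurable (Λ a) := fun a => measurable_of_finite _
  -- per-class bound
  have hclass : ∀ r < 2*k+1, μ {y | m * ε < |∑ l : Fin m,
      (Z (k + (r + (2*k+1) * l)) y - E (k + (r + (2*k+1) * l)))|}
      ≤ ENNReal.ofReal (2 * Real.exp (-(2 * m * ε^2) / Λmax^2)) := by
    intro r hr
    have hlt : ∀ (l : Fin m) (j : Fin (2*k+1)), r + (2*k+1) * l + j < n := by
      intro l j
      have h1 := l.2
      have h2 := j.2
      have h3 : (2*k+1) * (l.val + 1) ≤ (2*k+1) * m := Nat.mul_le_mul_left _ h1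
      rw [← hm, Nat.mul_succ] at h3
      omega
    let e : Fin m → Fin (2*k+1) → Fin n := fun l j => ⟨r + (2*k+1) * l + j, hlt l j⟩
    have he : Function.Injective (fun p : Fin m × Fin (2*k+1) => e p.1 p.2) := by
      rintro ⟨l, j⟩ ⟨l', j'⟩ h
      have h0 : r + (2*k+1) * l.val + j.val = r + (2*k+1) * l'.val + j'.val := congrArg Fin.val h
      have h1 : j.val + (2*k+1) * l.val = j'.val + (2*k+1) * l'.val := by omega
      have h2 := congrArg (· % (2*k+1)) h1
      have h3 := congrArg (· / (2*k+1)) h1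
      simp only [Nat.add_mul_mod_self_left, Nat.mod_eq_of_lt j.2, Nat.mod_eq_of_lt j'.2] at h2
      have h4 : l.val = l'.val := by
        rw [h2] at h1
        exact Nat.eq_of_mul_eq_mul_left (by omega : 0 < 2*k+1) (by omega)
      exact Prod.ext (Fin.ext h4) (Fin.ext h2)
    have hwin : ∀ (l : Fin m) (y : Fin n → ℝ),
        window k (ext y) (k + (r + (2*k+1) * l)) = fun j => y (e l j) := by
      intro l y
      funext j
      have : k + (r + (2*k+1) * l.val) - k + j.val = r + (2*k+1) * l + j := by omega
      simp only [window, ext, this, hlt l j, dif_pos, e]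
    have hind0 := indep_blocks
      (fun i : Fin n => (volume : Measure ℝ).withDensity fun t => ENNReal.ofReal (f (x i.val) t)) e he
    have hgm : ∀ l : Fin m, Measurable
        (fun w : Fin (2*k+1) → ℝ => Λ (x (k + (r + (2*k+1) * l))) (gk w)) :=
      fun l => (hlam _).comp hgk
    have hind : ProbabilityTheory.iIndepFun (fun l : Fin m => Z (k + (r + (2*k+1) * l))) μ := by
      have := hind0.comp (fun l w => Λ (x (k + (r + (2*k+1) * l))) (gk w)) hgm
      have heq : (fun l : Fin m => Z (k + (r + (2*k+1) * l))) = fun l : Fin m =>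
          (fun w => Λ (x (k + (r + (2*k+1) * l))) (gk w)) ∘ fun (ω : Fin n → ℝ) b => ω (e l b) := by
        funext l y
        simp only [hZ, hwin, Function.comp]
      rw [heq]
      exact this
    have hZE : ∀ l : Fin m, ∫ y, Z (k + (r + (2*k+1) * l)) y ∂μ = E (k + (r + (2*k+1) * l)) := by
      intro l
      have hmap := map_pi_inj
        (fun i : Fin n => (volume : Measure ℝ).withDensity fun t => ENNReal.ofReal (f (x i.val) t))
        (e l) (fun b b' h => (Prod.mk.inj (he (a₁ := (l, b)) (a₂ := (l, b')) h)).2)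
      simp only [hZ, hwin]
      have h1 : ∫ y, Λ (x (k + (r + (2*k+1) * l))) (gk (fun j => y (e l j))) ∂μ
          = ∫ w, Λ (x (k + (r + (2*k+1) * l))) (gk w) ∂(μ.map (fun ω j => ω (e l j))) := by
        rw [integral_map (by fun_prop : Measurable _).aemeasurable (hgm l).aestronglyMeasurable]
      rw [h1, hμ, lawSeq, hmap, pi_withDensity_ofReal (fun j => f (x (e l j).val))
        (fun j => hf_nonneg _) (fun j => hfI _) (fun j => hf_meas _),
        integral_withDensity_eq_integral_toReal_smul
          (by have := hf_meas; fun_prop) (ae_of_all _ fun _ => ENNReal.ofReal_lt_top)]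
      simp only [hE]
      refine integral_congr_ae (ae_of_all _ fun w => ?_)
      have : ∀ j : Fin (2*k+1), k + (r + (2*k+1) * l.val) - k + j.val = r + (2*k+1) * l + j :=
        fun j => by omega
      simp only [this, e, smul_eq_mul]
      rw [ENNReal.toReal_ofReal (Finset.prod_nonneg fun j _ => hf_nonneg _ _), mul_comm]
    have hfinal := hoeffding_two_sided μ m hm0 (fun l : Fin m => Z (k + (r + (2*k+1) * l)))
      (fun l => by
        simp only [hZ, hwin]
        exact (hgm l).comp (by fun_prop)) Λmax hΛmax (fun l y => hΛ _ _) hind ε hε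
    simp only [hZE] at hfinal
    exact hfinal
  have hN : ((n - 2*k : ℕ) : ℝ) = (2*k+1) * m := by rw [hm]; push_cast; ring
  have hmR : (0:ℝ) < m := by exact_mod_cast hm0
  have hsum : ∀ y, avgLoss n k Λ x gk y - risk f (empDist M n k x) Λ gk
      = (((2*k+1) * m : ℝ))⁻¹ * ∑ r ∈ Finset.range (2*k+1), ∑ l : Fin m,
      (Z (k + (r + (2*k+1) * l)) y - E (k + (r + (2*k+1) * l))) := by
    intro y
    rw [risk_eq, avgLoss, hN, ← mul_sub, ← Finset.sum_sub_distrib, Finset.sum_Ico_eq_sum_range]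
    have : n - k - k = (2*k+1) * m := by omega
    rw [this, sum_range_blocks]
  have hsubset : {y : Fin n → ℝ |
        ε < |avgLoss n k Λ x gk y - risk f (empDist M n k x) Λ gk|} ⊆
      ⋃ r ∈ Finset.range (2*k+1), {y | m * ε < |∑ l : Fin m,
      (Z (k + (r + (2*k+1) * l)) y - E (k + (r + (2*k+1) * l)))|} := by
    intro y hy
    by_contra hcon
    simp only [Set.mem_iUnion, Set.mem_ofPred_eq, not_exists, not_lt, Finset.mem_range] at hcon
    have hy' : ε < |avgLoss n k Λ x gk y - risk f (empDist M n k x) Λ gk| := hy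
    rw [hsum, abs_mul, abs_of_pos (by positivity)] at hy'
    have h1 := Finset.abs_sum_le_sum_abs (fun r : ℕ => ∑ l : Fin m,
      (Z (k + (r + (2*k+1) * l)) y - E (k + (r + (2*k+1) * l)))) (Finset.range (2*k+1))
    have h2 := Finset.sum_le_card_nsmul (Finset.range (2*k+1)) (fun r : ℕ => |∑ l : Fin m,
      (Z (k + (r + (2*k+1) * l)) y - E (k + (r + (2*k+1) * l)))|) (m * ε)
      (fun r hr => hcon r (Finset.mem_range.1 hr))
    rw [Finset.card_range, nsmul_eq_mul] at h2
    push_cast at h2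
    rw [inv_mul_eq_div, lt_div_iff₀ (by positivity)] at hy'
    nlinarith
  calc μ _ ≤ _ := measure_mono hsubset
    _ ≤ ∑ r ∈ Finset.range (2*k+1), _ := measure_biUnion_finset_le _ _
    _ ≤ ∑ r ∈ Finset.range (2*k+1), ENNReal.ofReal (2 * Real.exp (-(2 * m * ε^2) / Λmax^2)) :=
        Finset.sum_le_sum fun r hr => hclass r (Finset.mem_range.1 hr)
    _ = _ := by
        rw [Finset.sum_const, Finset.card_range, nsmul_eq_mul, ← ENNReal.ofReal_natCast,
          ← ENNReal.ofReal_mul (by positivity), hN]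
        congr 1
        have : -(2 * ((2*k+1) * m : ℝ) * ε^2) / ((2*k+1) * Λmax^2) = -(2 * m * ε^2) / Λmax^2 := by
          field_simp
        rw [this]
        push_cast
        ring


end GenCUDE
end
end

section
/- Assume (2k+1) divides (n−2k), and let ĥ^δ : ℝ^{2k+1} → A be the measurable rule with ĥ^δ(y_{-k}^k) = B(R_δ(P̂(X_0 | y_{-k}^k))) wherever p(y_{-k}^k) > 0 (defined arbitrarily but measurably elsewhere), so that X̂^δ_i(Y^n) = ĥ^δ(Y_{i−k}^{i+k}) for k+1 ≤ i ≤ n−k. Then for every ε > 0, Pr( |L_{X̂^δ}(x^n, Y^n) − R(ĥ^δ)| > ε ) ≤ (1/δ + 1)^M · 2·(2k+1)·exp( −2(n−2k)·ε² / ((2k+1)·Λ_max²) ), where the probability is over Y^n. -/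
open MeasureTheory Finset

noncomputable section
namespace GenCUDE

/-- Product of densities. -/
lemma aux_pi_withDensity {ι : Type} [Fintype ι] (F : ι → ℝ → ℝ) (hm : ∀ j, Measurable (F j))
    (h0 : ∀ j t, 0 ≤ F j t) (hi : ∀ j, Integrable (F j)) :
    Measure.pi (fun j => volume.withDensity fun t => ENNReal.ofReal (F j t)) =
      (volume : Measure (ι → ℝ)).withDensity fun y => ENNReal.ofReal (∏ j, F j (y j)) := by
  have : ∀ j, IsFiniteMeasure (volume.withDensity fun t => ENNReal.ofReal (F j t)) :=
    fun j => isFiniteMeasure_withDensity_ofReal (hi j).2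
  refine Measure.pi_eq fun s hs => ?_
  rw [withDensity_apply _ (MeasurableSet.univ_pi hs), ← lintegral_indicator (MeasurableSet.univ_pi hs)]
  have e1 : ∀ y : ι → ℝ, (Set.univ.pi s).indicator (fun y => ENNReal.ofReal (∏ j, F j (y j))) y
      = ENNReal.ofReal (∏ j, (s j).indicator (F j) (y j)) := by
    intro y
    by_cases hy : y ∈ Set.univ.pi s
    · rw [Set.indicator_of_mem hy]
      congr 1
      refine Finset.prod_congr rfl fun j _ => ?_
      rw [Set.indicator_of_mem (hy j trivial)]
    · rw [Set.indicator_of_notMem hy]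
      simp only [Set.mem_univ_pi, not_forall] at hy
      obtain ⟨j, hj⟩ := hy
      rw [Finset.prod_eq_zero (Finset.mem_univ j) (Set.indicator_of_notMem hj _)]
      simp
  have hi' : ∀ j, Integrable ((s j).indicator (F j)) := fun j => (hi j).indicator (hs j)
  have h0' : ∀ j t, 0 ≤ (s j).indicator (F j) t := fun j t =>
    Set.indicator_nonneg (fun t _ => h0 j t) t
  have hP : Integrable (fun y : ι → ℝ => ∏ j, (s j).indicator (F j) (y j)) :=
    Integrable.fintype_prod hi'
  simp_rw [e1]
  rw [← ofReal_integral_eq_lintegral_ofReal hP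
    (Filter.Eventually.of_forall fun y => Finset.prod_nonneg fun j _ => h0' j _),
    integral_fintype_prod_volume_eq_prod,
    ENNReal.ofReal_prod_of_nonneg (fun j _ => integral_nonneg (h0' j))]
  refine Finset.prod_congr rfl fun j _ => ?_
  rw [withDensity_apply _ (hs j), integral_indicator (hs j), ofReal_integral_eq_lintegral_ofReal
    (hi j).integrableOn (Filter.Eventually.of_forall (h0 j))]

/-- Grouping of independent random variables. -/
lemma aux_curry {Ω ι κ : Type} [Fintype ι] [Fintype κ] [MeasurableSpace Ω] (P : Measure Ω)
    [IsProbabilityMeasure P]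
    (X : ι → κ → Ω → ℝ) (mX : ∀ i j, Measurable (X i j))
    (h : ProbabilityTheory.iIndepFun (fun (p : ι × κ) ω => X p.1 p.2 ω) P) :
    ProbabilityTheory.iIndepFun (fun i ω j => X i j ω) P := by
  have : ∀ i j, IsProbabilityMeasure (P.map (X i j)) :=
    fun i j => Measure.isProbabilityMeasure_map (mX i j).aemeasurable
  have h2 : ∀ i, ProbabilityTheory.iIndepFun (X i) P := fun i =>
    h.precomp (g := fun j : κ => (i, j)) (fun a b hab => by simpa using hab)
  rw [ProbabilityTheory.iIndepFun_iff_map_fun_eq_infinitePi_map (by fun_prop)] at h ⊢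
  have e : (fun ω i j => X i j ω) = (MeasurableEquiv.curry ι κ ℝ) ∘
      (fun ω (p : ι × κ) => X p.1 p.2 ω) := by
    ext; simp
  rw [e, ← Measure.map_map (by fun_prop) (by fun_prop), h,
    Measure.infinitePi_map_curry (fun i j => P.map (X i j))]
  congr 1
  funext i
  rw [(ProbabilityTheory.iIndepFun_iff_map_fun_eq_infinitePi_map (by fun_prop)).1 (h2 i)]

lemma aux_prob {M : ℕ} (f : Fin M → ℝ → ℝ)
    (hf_nonneg : ∀ a t, 0 ≤ f a t) (hf_int : ∀ a, ∫ t, f a t = 1) (a : Fin M) :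
    Integrable (f a) ∧
    IsProbabilityMeasure (volume.withDensity fun t => ENNReal.ofReal (f a t)) := by
  have hi : Integrable (f a) := by
    by_contra hc
    have := hf_int a
    rw [integral_undef hc] at this
    norm_num at this
  refine ⟨hi, ⟨?_⟩⟩
  rw [withDensity_apply _ MeasurableSet.univ, Measure.restrict_univ,
    ← ofReal_integral_eq_lintegral_ofReal hi (Filter.Eventually.of_forall (hf_nonneg a)),
    hf_int, ENNReal.ofReal_one]

lemma aux_ext_meas {n : ℕ} (i : ℕ) : Measurable fun y : Fin n → ℝ => ext y i := by
  unfold ext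
  split_ifs <;> fun_prop

/-- Independence along an injective family of positions. -/
lemma aux_indep {M n : ℕ} (f : Fin M → ℝ → ℝ)
    (hf_nonneg : ∀ a t, 0 ≤ f a t) (hf_int : ∀ a, ∫ t, f a t = 1) (x : ℕ → Fin M)
    {ι : Type} (e : ι → ℕ) (he : Function.Injective e) (hn : ∀ i, e i < n) :
    ProbabilityTheory.iIndepFun (fun i (y : Fin n → ℝ) => ext y (e i)) (lawSeq n f x) := by
  have := fun a => (aux_prob f hf_nonneg hf_int a).2
  have h1 : ProbabilityTheory.iIndepFun (fun (i : Fin n) (y : Fin n → ℝ) => y i)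
      (lawSeq n f x) :=
    ProbabilityTheory.iIndepFun_pi (X := fun _ t => t) (fun i => aemeasurable_id)
  have h2 := h1.precomp (g := fun i : ι => (⟨e i, hn i⟩ : Fin n))
    (fun a b hab => he (by simpa using hab))
  have e1 : (fun i (y : Fin n → ℝ) => ext y (e i)) = fun i y => y ⟨e i, hn i⟩ := by
    funext i y
    simp [ext, hn i]
  rw [e1]
  exact h2

lemma aux_map {M n k : ℕ} (f : Fin M → ℝ → ℝ)
    (hf_nonneg : ∀ a t, 0 ≤ f a t) (hf_int : ∀ a, ∫ t, f a t = 1) (x : ℕ → Fin M)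
    (s : ℕ) (hs : s + 2 * k < n) :
    (lawSeq n f x).map (fun y (j : Fin (2*k+1)) => ext y (s + j.val)) =
      Measure.pi fun j : Fin (2*k+1) =>
        volume.withDensity fun t => ENNReal.ofReal (f (x (s + j.val)) t) := by
  have := fun a => (aux_prob f hf_nonneg hf_int a).2
  have : IsProbabilityMeasure (lawSeq n f x) := by unfold lawSeq; infer_instance
  have h1 := aux_indep (n := n) f hf_nonneg hf_int x (fun j : Fin (2*k+1) => s + j.val)
    (fun a b hab => by ext; simpa using hab) (fun j => by have := j.2; omega)
  rw [ProbabilityTheory.iIndepFun_iff_map_fun_eq_pi_map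
    (fun j => (aux_ext_meas _).aemeasurable)] at h1
  rw [h1]
  congr 1
  funext j
  have hj : s + j.val < n := by have := j.2; omega
  have e1 : (fun y : Fin n → ℝ => ext y (s + j.val)) = Function.eval ⟨s + j.val, hj⟩ := by
    funext y
    simp [ext, hj]
  rw [e1, lawSeq, (measurePreserving_eval _ _).map_eq]

lemma aux_integral {M n k : ℕ} (f : Fin M → ℝ → ℝ) (hf_meas : ∀ a, Measurable (f a))
    (hf_nonneg : ∀ a t, 0 ≤ f a t) (hf_int : ∀ a, ∫ t, f a t = 1) (x : ℕ → Fin M)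
    (s : ℕ) (hs : s + 2 * k < n) (G : (Fin (2*k+1) → ℝ) → ℝ) (hG : Measurable G) :
    ∫ y, G (fun j : Fin (2*k+1) => ext y (s + j.val)) ∂(lawSeq n f x) =
      ∫ y : Fin (2*k+1) → ℝ, G y * ∏ j, f (x (s + j.val)) (y j) := by
  rw [← integral_map (φ := fun y (j : Fin (2*k+1)) => ext y (s + j.val)) (f := G)
    (measurable_pi_lambda _ fun j => aux_ext_meas _).aemeasurable hG.aestronglyMeasurable,
    aux_map f hf_nonneg hf_int x s hs,
    aux_pi_withDensity (fun j : Fin (2*k+1) => f (x (s + j.val))) (fun j => hf_meas _)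
      (fun j => hf_nonneg _) (fun j => (aux_prob f hf_nonneg hf_int _).1),
    integral_withDensity_eq_integral_toReal_smul (by fun_prop) (by simp)]
  refine integral_congr_ae (Filter.Eventually.of_forall fun y => ?_)
  simp only [smul_eq_mul]
  rw [ENNReal.toReal_ofReal (Finset.prod_nonneg fun j _ => hf_nonneg _ _), mul_comm]

/-- The loss at position `s + k`. -/
def auxV {M : ℕ} (n k : ℕ) (Λ : Matrix (Fin M) (Fin M) ℝ) (x : ℕ → Fin M)
    (h : (Fin (2*k+1) → ℝ) → Fin M) (s : ℕ) (y : Fin n → ℝ) : ℝ :=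
  Λ (x (s + k)) (h fun j : Fin (2*k+1) => ext y (s + j.val))

lemma aux_avgLoss {M : ℕ} (n k : ℕ) (Λ : Matrix (Fin M) (Fin M) ℝ) (x : ℕ → Fin M)
    (h : (Fin (2*k+1) → ℝ) → Fin M) (y : Fin n → ℝ) :
    avgLoss n k Λ x h y =
      (((n - 2*k : ℕ) : ℝ))⁻¹ * ∑ s ∈ Finset.range (n - 2*k), auxV n k Λ x h s y := by
  unfold avgLoss
  rw [Finset.sum_Ico_eq_sum_range, show n - k - k = n - 2 * k by omega]
  congr 1
  refine Finset.sum_congr rfl fun s _ => ?_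
  unfold auxV window
  rw [add_comm k s]
  simp

lemma aux_risk {M : ℕ} (n k : ℕ) (f : Fin M → ℝ → ℝ) (hf_meas : ∀ a, Measurable (f a))
    (hf_nonneg : ∀ a t, 0 ≤ f a t) (hf_int : ∀ a, ∫ t, f a t = 1) (x : ℕ → Fin M)
    (Λ : Matrix (Fin M) (Fin M) ℝ)
    (h : (Fin (2*k+1) → ℝ) → Fin M) (hh : Measurable h) :
    risk f (empDist M n k x) Λ h =
      (((n - 2*k : ℕ) : ℝ))⁻¹ * ∑ s ∈ Finset.range (n - 2*k),
        ∫ y, auxV n k Λ x h s y ∂(lawSeq n f x) := by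
  unfold risk empDist
  set J : (Fin (2*k+1) → Fin M) → ℝ := fun u =>
    ∫ y : Fin (2*k+1) → ℝ, Λ (u (center k)) (h y) * ∏ j, f (u j) (y j) with hJ
  have e1 : ∀ s ∈ Finset.range (n - 2*k), ∫ y, auxV n k Λ x h s y ∂(lawSeq n f x)
      = J (fun j => x (s + j.val)) := by
    intro s hs
    rw [Finset.mem_range] at hs
    exact aux_integral f hf_meas hf_nonneg hf_int x s (by omega)
      (fun w => Λ (x (s + k)) (h w)) ((measurable_from_top (f := Λ (x (s+k)))).comp hh)
  rw [Finset.sum_congr rfl e1]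
  have e2 : ∑ s ∈ Finset.range (n - 2*k), J (fun j => x (s + j.val)) =
      ∑ i ∈ Finset.Ico k (n - k), J (fun j => x (i - k + j.val)) := by
    rw [Finset.sum_Ico_eq_sum_range, show n - k - k = n - 2 * k by omega]
    simp
  rw [e2, Finset.mul_sum]
  have e3 : ∀ u : Fin (2*k+1) → Fin M,
      ((((Finset.Ico k (n - k)).filter
      fun i => ∀ j : Fin (2*k+1), x (i - k + j.val) = u j).card : ℝ) / ((n - 2*k : ℕ) : ℝ)) * J u
      = ∑ i ∈ Finset.Ico k (n - k), if u = (fun j => x (i - k + j.val)) then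
        ((n - 2*k : ℕ) : ℝ)⁻¹ * J u else 0 := by
    intro u
    rw [← Finset.sum_filter, Finset.sum_const, nsmul_eq_mul]
    have : ((Finset.Ico k (n - k)).filter fun i => ∀ j : Fin (2*k+1), x (i - k + j.val) = u j)
        = (Finset.Ico k (n - k)).filter fun i => u = (fun j => x (i - k + j.val)) := by
      refine Finset.filter_congr fun i _ => ?_
      rw [funext_iff]
      exact ⟨fun h j => (h j).symm, fun h j => (h j).symm⟩
    rw [this]
    ring
  rw [Finset.sum_congr rfl fun u _ => e3 u, Finset.sum_comm]
  refine Finset.sum_congr rfl fun i _ => ?_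
  rw [Finset.sum_ite_eq' ]
  simp

/-- Hoeffding for one residue class. -/
lemma aux_class {M n k : ℕ} (f : Fin M → ℝ → ℝ)
    (hf_nonneg : ∀ a t, 0 ≤ f a t) (hf_int : ∀ a, ∫ t, f a t = 1) (x : ℕ → Fin M)
    (Λ : Matrix (Fin M) (Fin M) ℝ) (Λmax : ℝ) (hΛmax : 0 < Λmax)
    (hΛ : ∀ a b, Λ a b ∈ Set.Icc 0 Λmax)
    (h : (Fin (2*k+1) → ℝ) → Fin M) (hh : Measurable h)
    (m r : ℕ) (hm : n - 2*k = (2*k+1) * m) (hm0 : 0 < m) (hr : r < 2*k+1) (ε : ℝ) (hε : 0 < ε) :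
    lawSeq n f x {y : Fin n → ℝ | m * ε ≤ |∑ q : Fin m, (auxV n k Λ x h (r + (2*k+1)*q.val) y
      - ∫ z, auxV n k Λ x h (r + (2*k+1)*q.val) z ∂(lawSeq n f x))|} ≤
      ENNReal.ofReal (2 * Real.exp (-(2 * m * ε^2 / Λmax^2))) := by
  have := fun a => (aux_prob f hf_nonneg hf_int a).2
  have : IsProbabilityMeasure (lawSeq n f x) := by unfold lawSeq; infer_instance
  set μ := lawSeq n f x with hμ
  have hI := aux_curry μ (fun (q : Fin m) (j : Fin (2*k+1)) (y : Fin n → ℝ) =>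
      ext y (r + (2*k+1)*q.val + j.val)) (fun _ _ => aux_ext_meas _)
    (aux_indep f hf_nonneg hf_int x
      (fun p : Fin m × Fin (2*k+1) => r + (2*k+1)*p.1.val + p.2.val)
      (by
        rintro ⟨a, b⟩ ⟨c, d⟩ hab
        simp only at hab
        have hb := b.2
        have hd := d.2
        have h1 : (2*k+1)*a.val + b.val = (2*k+1)*c.val + d.val := by omega
        have h2 : a.val = c.val := by
          have := congrArg (· / (2*k+1)) h1
          simpa [Nat.mul_add_div, Nat.div_eq_of_lt hb, Nat.div_eq_of_lt hd] using this
        rw [h2] at h1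
        ext
        · exact h2
        · simp only; omega)
      (by
        rintro ⟨a, b⟩
        have hb := b.2
        have ha : a.val + 1 ≤ m := a.2
        have : (2*k+1) * (a.val + 1) ≤ (2*k+1) * m := Nat.mul_le_mul_left _ ha
        rw [← hm, mul_add] at this
        simp only
        omega))
  have hmeas : ∀ s, Measurable (auxV n k Λ x h s) := fun s =>
    (measurable_from_top (f := Λ (x (s+k)))).comp
      (hh.comp (measurable_pi_lambda _ fun j => aux_ext_meas _))
  have hI2 := hI.comp (fun (q : Fin m) w => Λ (x (r + (2*k+1)*q.val + k)) (h w)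
      - ∫ z, auxV n k Λ x h (r + (2*k+1)*q.val) z ∂μ)
    (fun q => ((measurable_from_top (f := Λ (x (r + (2*k+1)*q.val + k)))).comp hh).sub_const _)
  set X : Fin m → (Fin n → ℝ) → ℝ := fun q y => auxV n k Λ x h (r + (2*k+1)*q.val) y
      - ∫ z, auxV n k Λ x h (r + (2*k+1)*q.val) z ∂μ with hX
  have hI3 : ProbabilityTheory.iIndepFun X μ := hI2
  have hsub : ∀ q ∈ (Finset.univ : Finset (Fin m)),
      ProbabilityTheory.HasSubgaussianMGF (X q) ((‖Λmax - 0‖₊ / 2) ^ 2) μ := fun q _ =>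
    ProbabilityTheory.hasSubgaussianMGF_of_mem_Icc (hmeas _).aemeasurable
      (Filter.Eventually.of_forall fun y => hΛ _ _)
  have hS := ProbabilityTheory.HasSubgaussianMGF.sum_of_iIndepFun hI3 hsub
  have hpos : (0:ℝ) ≤ m * ε := by positivity
  have hmR : (0:ℝ) < m := by exact_mod_cast hm0
  have hexp : -(m * ε)^2 / (2 * ((∑ q : Fin m, ((‖Λmax - 0‖₊ / 2) ^ 2 : NNReal) : NNReal) : ℝ))
      = -(2 * m * ε^2 / Λmax^2) := by
    simp only [sub_zero, Finset.sum_const, Finset.card_univ, Fintype.card_fin, nsmul_eq_mul,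
      NNReal.coe_mul, NNReal.coe_natCast, NNReal.coe_pow, NNReal.coe_div, coe_nnnorm,
      NNReal.coe_ofNat, Real.norm_eq_abs, div_pow, sq_abs]
    field_simp
    try norm_num
  have b1 := hS.measure_ge_le hpos
  have b2 := hS.neg.measure_ge_le hpos
  rw [hexp] at b1 b2
  have hset : {y : Fin n → ℝ | m * ε ≤ |∑ q : Fin m, X q y|} ⊆
      {y | m * ε ≤ ∑ q : Fin m, X q y} ∪ {y | m * ε ≤ (-fun y => ∑ q : Fin m, X q y) y} := by
    intro y hy
    rw [Set.mem_ofPred_eq] at hy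
    rcases le_abs.1 hy with h | h
    · exact Or.inl h
    · exact Or.inr h
  have b3 : μ.real {y : Fin n → ℝ | m * ε ≤ |∑ q : Fin m, X q y|} ≤
      2 * Real.exp (-(2 * m * ε^2 / Λmax^2)) := by
    refine (measureReal_mono hset).trans ((measureReal_union_le _ _).trans ?_)
    linarith
  rw [← ofReal_measureReal]
  exact ENNReal.ofReal_le_ofReal b3

lemma aux_reindex (L m : ℕ) (a : ℕ → ℝ) :
    ∑ s ∈ Finset.range (L * m), a s = ∑ r ∈ Finset.range L, ∑ q : Fin m, a (r + L * q.val) := by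
  rw [Finset.sum_congr rfl fun r _ => Fin.sum_univ_eq_sum_range (fun q => a (r + L * q)) m]
  rw [Finset.sum_comm]
  induction m with
  | zero => simp
  | succ m ih =>
    rw [Finset.sum_range_succ, ← ih, Nat.mul_succ, Finset.sum_range_add]
    simp [add_comm]

/-- Main bound without the (superfluous) covering prefactor. -/
lemma aux_main {M n k : ℕ} (hn : 2*k < n) (hdiv : (2*k+1) ∣ (n - 2*k))
    (f : Fin M → ℝ → ℝ) (hf_meas : ∀ a, Measurable (f a))
    (hf_nonneg : ∀ a t, 0 ≤ f a t) (hf_int : ∀ a, ∫ t, f a t = 1) (x : ℕ → Fin M)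
    (Λ : Matrix (Fin M) (Fin M) ℝ) (Λmax : ℝ) (hΛmax : 0 < Λmax)
    (hΛ : ∀ a b, Λ a b ∈ Set.Icc 0 Λmax)
    (h : (Fin (2*k+1) → ℝ) → Fin M) (hh : Measurable h) (ε : ℝ) (hε : 0 < ε) :
    lawSeq n f x {y : Fin n → ℝ |
        ε < |avgLoss n k Λ x h y - risk f (empDist M n k x) Λ h|}
      ≤ ENNReal.ofReal ((2 * (2*k+1)) *
          Real.exp (-(2 * ((n - 2*k : ℕ) : ℝ) * ε^2) / ((2*k+1) * Λmax^2))) := by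
  obtain ⟨m, hm⟩ := hdiv
  have hm0 : 0 < m := by
    rcases Nat.eq_zero_or_pos m with h0 | h0
    · rw [h0] at hm; omega
    · exact h0
  have hmR : (0:ℝ) < m := by exact_mod_cast hm0
  set S : ℕ → Set (Fin n → ℝ) := fun r => {y : Fin n → ℝ | m * ε ≤
    |∑ q : Fin m, (auxV n k Λ x h (r + (2*k+1)*q.val) y
      - ∫ z, auxV n k Λ x h (r + (2*k+1)*q.val) z ∂(lawSeq n f x))|} with hS
  have hsub : {y : Fin n → ℝ |
        ε < |avgLoss n k Λ x h y - risk f (empDist M n k x) Λ h|} ⊆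
      ⋃ r ∈ Finset.range (2*k+1), S r := by
    intro y hy
    by_contra hc
    simp only [Set.mem_iUnion, not_exists] at hc
    have hc' : ∀ r ∈ Finset.range (2*k+1),
      |∑ q : Fin m, (auxV n k Λ x h (r + (2*k+1)*q.val) y
      - ∫ z, auxV n k Λ x h (r + (2*k+1)*q.val) z ∂(lawSeq n f x))| ≤ m * ε :=
      fun r hr => (not_le.1 (hc r hr)).le
    rw [Set.mem_ofPred_eq, aux_avgLoss, aux_risk n k f hf_meas hf_nonneg hf_int x Λ h hh,
      ← mul_sub, ← Finset.sum_sub_distrib, hm, aux_reindex, abs_mul] at hy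
    have h1 := (Finset.abs_sum_le_sum_abs _ _).trans (Finset.sum_le_sum hc')
    rw [Finset.sum_const, Finset.card_range, nsmul_eq_mul] at h1
    have hp : (0:ℝ) < (((2*k+1) * m : ℕ) : ℝ) := by positivity
    rw [abs_of_pos (inv_pos.2 hp)] at hy
    have h2 := mul_le_mul_of_nonneg_left h1 (inv_pos.2 hp).le
    have h3 : (((2*k+1) * m : ℕ) : ℝ)⁻¹ * (((2*k+1 : ℕ) : ℝ) * (m * ε)) = ε := by
      push_cast
      field_simp
    rw [h3] at h2
    exact absurd hy (not_lt.2 h2)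
  refine (measure_mono hsub).trans ((measure_biUnion_finset_le _ _).trans ?_)
  refine (Finset.sum_le_sum fun r hr => aux_class f hf_nonneg hf_int x Λ Λmax hΛmax hΛ h hh m r
    hm hm0 (Finset.mem_range.1 hr) ε hε).trans (le_of_eq ?_)
  rw [Finset.sum_const, Finset.card_range, ← ENNReal.ofReal_nsmul, nsmul_eq_mul, hm]
  congr 1
  have : -(2 * (((2*k+1) * m : ℕ) : ℝ) * ε^2) / ((2*k+1) * Λmax^2)
      = -(2 * m * ε^2 / Λmax^2) := by
    push_cast
    field_simp
  rw [this]
  push_cast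
  ring

/-- Lemma 7 of the paper: with `P = P^k_{x^n}`, for the measurable rule
`ĥ^δ` that is a Bayes response with respect to the quantized approximate posterior
`R_δ(P̂)` wherever `p(y_{-k}^k) > 0`,
`Pr(|L_{X̂^δ}(x^n,Y^n) − R(ĥ^δ)| > ε) ≤ (1/δ+1)^M · 2(2k+1) exp(−2(n−2k)ε²/((2k+1)Λ_max²))`. -/
theorem statement12
    (M n k : ℕ) (hM : 2 ≤ M) (hk : 1 ≤ k) (hn : 2*k < n)
    (hdiv : (2*k+1) ∣ (n - 2*k))
    (f : Fin M → ℝ → ℝ) (hf_meas : ∀ a, Measurable (f a))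
    (hf_nonneg : ∀ a t, 0 ≤ f a t) (hf_int : ∀ a, ∫ t, f a t = 1)
    (Q : ℝ → Fin M) (hQ : Measurable Q)
    (Pi : Matrix (Fin M) (Fin M) ℝ)
    (hPi : ∀ a z, Pi a z = ∫ t in {s : ℝ | Q s = z}, f a t)
    (hPi_inv : IsUnit Pi.det)
    (Λ : Matrix (Fin M) (Fin M) ℝ) (Λmax : ℝ) (hΛmax : 0 < Λmax)
    (hΛ : ∀ a b, Λ a b ∈ Set.Icc 0 Λmax)
    (x : ℕ → Fin M)
    (g : (Fin (2*k) → ℝ) → Fin M → ℝ) (hg_meas : Measurable g)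
    (hg_simplex : ∀ c, (∀ z, 0 ≤ g c z) ∧ ∑ z, g c z = 1)
    (hhat_range : ∀ y : Fin (2*k+1) → ℝ, 0 < pFull f (empDist M n k x) y →
      ∀ a, postHat f (empDist M n k x) Pi g y a ∈ Set.Icc (0:ℝ) 1)
    (N : ℕ) (hN : 0 < N) (δ : ℝ) (hδ : δ = 1 / N)
    (Rδ : (Fin M → ℝ) → (Fin M → ℝ))
    (hR_grid : ∀ v : Fin M → ℝ, (∀ i, v i ∈ Set.Icc (0:ℝ) 1) →
      ∀ i, ∃ m : ℕ, m ≤ N ∧ Rδ v i = m * δ)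
    (hR_near : ∀ v : Fin M → ℝ, (∀ i, v i ∈ Set.Icc (0:ℝ) 1) →
      ∀ i, ∀ m : ℕ, m ≤ N → |Rδ v i - v i| ≤ |m * δ - v i|)
    (hhatδ : (Fin (2*k+1) → ℝ) → Fin M) (hhatδ_meas : Measurable hhatδ)
    (hhatδ_bayes : ∀ y : Fin (2*k+1) → ℝ, 0 < pFull f (empDist M n k x) y →
      IsBayes Λ (Rδ (postHat f (empDist M n k x) Pi g y)) (hhatδ y))
    (ε : ℝ) (hε : 0 < ε) :
    lawSeq n f x {y : Fin n → ℝ |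
        ε < |avgLoss n k Λ x hhatδ y - risk f (empDist M n k x) Λ hhatδ|}
      ≤ ENNReal.ofReal ((1/δ + 1)^M * (2 * (2*k+1)) *
          Real.exp (-(2 * ((n - 2*k : ℕ) : ℝ) * ε^2) / ((2*k+1) * Λmax^2))) := by
  refine (aux_main hn hdiv f hf_meas hf_nonneg hf_int x Λ Λmax hΛmax hΛ hhatδ hhatδ_meas ε
    hε).trans (ENNReal.ofReal_le_ofReal ?_)
  have hδ0 : 0 ≤ 1 / δ := by rw [hδ]; positivity
  have h1 : (1:ℝ) ≤ (1/δ + 1)^M := one_le_pow₀ (by linarith)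
  rw [mul_assoc ((1/δ + 1)^M)]
  exact le_mul_of_one_le_left (by positivity) h1

end GenCUDE
end
end
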